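/- arXiv:2012.11728 — 5 statements merged into one kernel-verified Lean document; each statement's English description precedes it below -/
import Mathlib

section
/- Let n ≥ 5, and let M be a symmetric non-degenerate real (n−1)×(n−1) matrix (i.e. an invertible self-adjoint linear map of ℝ^{n−1}). Define F on the configuration space 𝔽₂(ℝ^{n−1}) = {(x,y) ∈ ℝ^{n−1}×ℝ^{n−1} : x ≠ y} by F(x,y) = (1/2)⟨Mx,x⟩ + (1/2)⟨My,y⟩ + 1/|x−y|^{n−2}. If M has at least one positive eigenvalue, then F admits at least one critical point, i.e. there exists (x,y) with x ≠ y at which the Fréchet derivative of F vanishes. -/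
open scoped RealInnerProductSpace

section

variable {E : Type*} [NormedAddCommGroup E] [InnerProductSpace ℝ E]

/-- The derivative of the norm of a real inner product space away from the origin. -/
theorem hasFDerivAt_norm_of_ne_zero {d : E} (hd : d ≠ 0) :
    HasFDerivAt (fun z : E => ‖z‖) (‖d‖⁻¹ • innerSL ℝ d) d := by
  have hd' : ‖d‖ ≠ 0 := norm_ne_zero_iff.mpr hd
  have h := (hasStrictFDerivAt_norm_sq d).hasFDerivAt.sqrt (pow_ne_zero 2 hd')
  simp only [Real.sqrt_sq (norm_nonneg _)] at h
  convert h using 1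
  ext z
  simp
  field_simp

/-- The derivative of `x ↦ 1 / ‖x‖ ^ m` away from the origin. -/
theorem hasFDerivAt_one_div_norm_pow {d : E} (hd : d ≠ 0) (m : ℕ) :
    HasFDerivAt (fun z : E => 1 / ‖z‖ ^ m) (-(m / ‖d‖ ^ (m + 2)) • innerSL ℝ d) d := by
  have hd' : ‖d‖ ≠ 0 := norm_ne_zero_iff.mpr hd
  have h := (hasDerivAt_inv (pow_ne_zero m hd')).comp_hasFDerivAt d
    ((hasFDerivAt_norm_of_ne_zero hd).pow m)
  simp only [one_div]
  refine h.congr_fderiv ?_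
  ext z
  rcases m with _ | m
  · simp
  · simp
    field_simp
    ring

/-- The derivative of the quadratic form of a symmetric continuous linear map. -/
theorem hasFDerivAt_half_inner_self (T : E →L[ℝ] E) (hT : ∀ x y, ⟪T x, y⟫ = ⟪x, T y⟫) (x : E) :
    HasFDerivAt (fun z : E => (1 / 2) * ⟪T z, z⟫) (innerSL ℝ (T x)) x := by
  refine ((T.hasFDerivAt.inner ℝ (hasFDerivAt_id x)).const_mul (1 / 2)).congr_fderiv ?_
  ext z
  simp [hT z x, real_inner_comm z (T x)]
  ring

/-- An eigenvector can be rescaled to any prescribed norm. -/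
theorem exists_eigenvector_norm_eq (T : E →ₗ[ℝ] E) {lam : ℝ} {v : E} (hv : v ≠ 0)
    (hTv : T v = lam • v) {r : ℝ} (hr : 0 ≤ r) : ∃ w : E, ‖w‖ = r ∧ T w = lam • w := by
  refine ⟨(r / ‖v‖) • v, ?_, ?_⟩
  · rw [norm_smul, Real.norm_of_nonneg (by positivity),
      div_mul_cancel₀ _ (norm_ne_zero_iff.mpr hv)]
  · rw [map_smul, hTv, smul_comm]

end

/-- If the symmetric non-degenerate matrix `M` has a positive eigenvalue,
then the Kirchhoff-Routh type function `F` has a critical point on the configuration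
space `𝔽₂(ℝ^{n-1})`. -/
theorem stmt_0 (n : ℕ) (hn : 5 ≤ n)
    (M : EuclideanSpace ℝ (Fin (n - 1)) →ₗ[ℝ] EuclideanSpace ℝ (Fin (n - 1)))
    (hsymm : ∀ x y, ⟪M x, y⟫ = ⟪x, M y⟫)
    (hnondeg : Function.Bijective M)
    (hpos : ∃ (lam : ℝ) (v : EuclideanSpace ℝ (Fin (n - 1))),
      0 < lam ∧ v ≠ 0 ∧ M v = lam • v)
    (F : EuclideanSpace ℝ (Fin (n - 1)) × EuclideanSpace ℝ (Fin (n - 1)) → ℝ)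
    (hF : ∀ p, F p = (1 / 2) * ⟪M p.1, p.1⟫ + (1 / 2) * ⟪M p.2, p.2⟫
      + 1 / ‖p.1 - p.2‖ ^ (n - 2)) :
    ∃ p : EuclideanSpace ℝ (Fin (n - 1)) × EuclideanSpace ℝ (Fin (n - 1)),
      p.1 ≠ p.2 ∧ fderiv ℝ F p = 0 := by
  obtain ⟨lam, v, hlam, hv, hMv⟩ := hpos
  obtain ⟨m, rfl⟩ : ∃ m, n = m + 2 := ⟨n - 2, by omega⟩
  simp only [Nat.add_sub_cancel] at hF
  have hm : (0 : ℝ) < m := by exact_mod_cast (by omega : 0 < m)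
  obtain ⟨r, hr, hrpow⟩ : ∃ r : ℝ, 0 < r ∧ r ^ (m + 2) = 2 * m / lam :=
    ⟨(2 * m / lam) ^ (((m + 2 : ℕ) : ℝ)⁻¹), by positivity,
      Real.rpow_inv_natCast_pow (by positivity) (by omega)⟩
  obtain ⟨w, hwr, hMw⟩ := exists_eigenvector_norm_eq M hv hMv hr.le
  have hw : w ≠ 0 := norm_pos_iff.mp (hwr ▸ hr)
  -- The critical point is `(w / 2, -w / 2)`, with `‖w‖ ^ n = 2 (n - 2) / lam`.
  have hsub : (1 / 2 : ℝ) • w - (-(1 / 2) : ℝ) • w = w := by module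
  refine ⟨((1 / 2 : ℝ) • w, (-(1 / 2) : ℝ) • w), fun h => hw ?_, ?_⟩
  · rw [← hsub]
    exact sub_eq_zero.mpr h
  set p := ((1 / 2 : ℝ) • w, (-(1 / 2) : ℝ) • w) with hp
  have hd : p.1 - p.2 = w := hsub
  let T := M.toContinuousLinearMap
  have h₁ := (hasFDerivAt_half_inner_self T hsymm p.1).comp p hasFDerivAt_fst
  have h₂ := (hasFDerivAt_half_inner_self T hsymm p.2).comp p hasFDerivAt_snd
  have h₃ := (hasFDerivAt_one_div_norm_pow (hd.symm ▸ hw : p.1 - p.2 ≠ 0) m).comp p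
    (hasFDerivAt_fst.sub hasFDerivAt_snd)
  have hFp : HasFDerivAt F _ p :=
    ((h₁.add h₂).add h₃).congr_of_eventuallyEq (Filter.Eventually.of_forall hF)
  rw [hFp.fderiv, hd, hwr, hrpow]
  refine ContinuousLinearMap.ext fun q => ?_
  simp [T, hp, hMw]
  field_simp
  ring
end

section
/- Let n ≥ 5, and let M be a symmetric non-degenerate real (n−1)×(n−1) matrix. Define F on the configuration space 𝔽₂(ℝ^{n−1}) = {(x,y) ∈ ℝ^{n−1}×ℝ^{n−1} : x ≠ y} by F(x,y) = (1/2)⟨Mx,x⟩ + (1/2)⟨My,y⟩ + 1/|x−y|^{n−2}. If λ > 0 is a simple eigenvalue of M (its eigenspace is one-dimensional), then F has a non-degenerate critical point (x_λ, y_λ): the Fréchet derivative of F vanishes at (x_λ,y_λ) and the second Fréchet derivative of F at (x_λ,y_λ), viewed as a bilinear form on ℝ^{n−1}×ℝ^{n−1}, has trivial kernel. -/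
open scoped RealInnerProductSpace

section PowerOfDifference

variable {E : Type*} [NormedAddCommGroup E] [InnerProductSpace ℝ E]

/-- The real inner product as a linear map into continuous linear maps. -/
noncomputable def realInnerCLM (E : Type*) [NormedAddCommGroup E] [InnerProductSpace ℝ E] :
    E →L[ℝ] E →L[ℝ] ℝ :=
  (isBoundedBilinearMap_inner (𝕜 := ℝ) (E := E)).toContinuousLinearMap

@[simp]
theorem realInnerCLM_apply (x y : E) : realInnerCLM E x y = ⟪x, y⟫ := rfl

/-- The map `(x, y) ↦ x - y`. -/
noncomputable def diffCLM (E : Type*) [NormedAddCommGroup E] [InnerProductSpace ℝ E] :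
    E × E →L[ℝ] E :=
  ContinuousLinearMap.fst ℝ E E - ContinuousLinearMap.snd ℝ E E

@[simp]
theorem diffCLM_apply (p : E × E) : diffCLM E p = p.1 - p.2 := rfl

/-- The bilinear form `(p, q) ↦ ⟪S p, T q⟫` in curried form. -/
noncomputable def innerPullback (S T : E × E →L[ℝ] E) : E × E →L[ℝ] E × E →L[ℝ] ℝ :=
  ((ContinuousLinearMap.compL ℝ (E × E) E ℝ).flip T).comp ((realInnerCLM E).comp S)

@[simp]
theorem innerPullback_apply (S T : E × E →L[ℝ] E) (p q : E × E) :
    innerPullback S T p q = ⟪S p, T q⟫ := rfl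

/-- The bilinear form of the quadratic form `(x, y) ↦ ⟪M x, x⟫ + ⟪M y, y⟫`. -/
noncomputable def sumForm (M : E →L[ℝ] E) : E × E →L[ℝ] E × E →L[ℝ] ℝ :=
  innerPullback (M.comp (ContinuousLinearMap.fst ℝ E E)) (ContinuousLinearMap.fst ℝ E E) +
    innerPullback (M.comp (ContinuousLinearMap.snd ℝ E E)) (ContinuousLinearMap.snd ℝ E E)

@[simp]
theorem sumForm_apply (M : E →L[ℝ] E) (p q : E × E) :
    sumForm M p q = ⟪M p.1, q.1⟫ + ⟪M p.2, q.2⟫ := rfl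

theorem hasFDerivAt_half_sumForm (M : E →L[ℝ] E) (hM : ∀ x y, ⟪M x, y⟫ = ⟪x, M y⟫)
    (p : E × E) :
    HasFDerivAt (fun p : E × E => (1 / 2) * ⟪M p.1, p.1⟫ + (1 / 2) * ⟪M p.2, p.2⟫)
      (sumForm M p) p := by
  have h := (((sumForm M).hasFDerivAt (x := p)).clm_apply (hasFDerivAt_id p)).const_mul (1 / 2 : ℝ)
  refine (h.congr_fderiv ?_).congr_of_eventuallyEq (.of_forall fun q => ?_)
  · refine ContinuousLinearMap.ext fun q => ?_
    simp [hM q.1, hM q.2, real_inner_comm (M p.1), real_inner_comm (M p.2)]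
    ring
  · simp only [sumForm_apply, id]
    ring

theorem hasFDerivAt_normSq_rpow_sub (s : ℝ) {p : E × E} (hp : p.1 ≠ p.2) :
    HasFDerivAt (fun p : E × E => (‖p.1 - p.2‖ ^ 2) ^ s)
      ((2 * s * (‖p.1 - p.2‖ ^ 2) ^ (s - 1)) • innerPullback (diffCLM E) (diffCLM E) p) p := by
  have h0 : ‖p.1 - p.2‖ ^ 2 ≠ 0 := by simpa [sub_eq_zero] using hp
  have h := (((diffCLM E).hasFDerivAt (x := p)).norm_sq).rpow_const (p := s) (.inl h0)
  refine h.congr_fderiv (ContinuousLinearMap.ext fun q => ?_)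
  simp [inner_sub_left]
  ring

theorem HasFDerivAt.smul_bilinear {V : Type*} [NormedAddCommGroup V] [NormedSpace ℝ V]
    {c : V → ℝ} {c' : V →L[ℝ] ℝ} {x : V} (hc : HasFDerivAt c c' x) (B : V →L[ℝ] V →L[ℝ] ℝ) :
    HasFDerivAt (fun y => c y • B y) (c x • B + c'.smulRight (B x)) x :=
  hc.smul B.hasFDerivAt

/-- The first two derivatives of `⟪M x, x⟫ / 2 + ⟪M y, y⟫ / 2 + ‖x - y‖ ^ (2 * s)`. -/
theorem fderiv_and_fderiv_fderiv (M : E →L[ℝ] E) (hM : ∀ x y, ⟪M x, y⟫ = ⟪x, M y⟫) (s : ℝ)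
    {F : E × E → ℝ}
    (hF : ∀ p, p.1 ≠ p.2 → F p = (1 / 2) * ⟪M p.1, p.1⟫ + (1 / 2) * ⟪M p.2, p.2⟫ +
      (‖p.1 - p.2‖ ^ 2) ^ s) {p : E × E} (hp : p.1 ≠ p.2) :
    fderiv ℝ F p = sumForm M p +
        (2 * s * (‖p.1 - p.2‖ ^ 2) ^ (s - 1)) • innerPullback (diffCLM E) (diffCLM E) p ∧
    ∀ w v, fderiv ℝ (fderiv ℝ F) p w v = ⟪M w.1, v.1⟫ + ⟪M w.2, v.2⟫ +
      2 * s * (‖p.1 - p.2‖ ^ 2) ^ (s - 1) * ⟪w.1 - w.2, v.1 - v.2⟫ +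
      4 * s * (s - 1) * (‖p.1 - p.2‖ ^ 2) ^ (s - 2) * ⟪p.1 - p.2, w.1 - w.2⟫ *
        ⟪p.1 - p.2, v.1 - v.2⟫ := by
  have hopen : IsOpen {p : E × E | p.1 ≠ p.2} := isOpen_ne_fun continuous_fst continuous_snd
  have hfirst : ∀ p : E × E, p.1 ≠ p.2 → fderiv ℝ F p = sumForm M p +
      (2 * s * (‖p.1 - p.2‖ ^ 2) ^ (s - 1)) • innerPullback (diffCLM E) (diffCLM E) p := by
    intro p hp
    refine HasFDerivAt.fderiv ?_
    refine ((hasFDerivAt_half_sumForm M hM p).add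
      (hasFDerivAt_normSq_rpow_sub s hp)).congr_of_eventuallyEq ?_
    filter_upwards [hopen.mem_nhds hp] with q hq using hF q hq
  refine ⟨hfirst p hp, fun w v => ?_⟩
  have hcoeff := (hasFDerivAt_normSq_rpow_sub (s - 1) hp).const_mul (2 * s)
  have h := ((sumForm M).hasFDerivAt (x := p)).add
    (hcoeff.smul_bilinear (innerPullback (diffCLM E) (diffCLM E)))
  have h' := h.congr_of_eventuallyEq (f₁ := fderiv ℝ F) (by
    filter_upwards [hopen.mem_nhds hp] with q hq using hfirst q hq)
  rw [h'.fderiv, show s - 1 - 1 = s - 2 by ring]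
  simp
  ring

/-- A positive simple eigenvalue yields a non-degenerate critical point. -/
theorem exists_nondegenerate_critical_point (M : E →L[ℝ] E)
    (hM : ∀ x y, ⟪M x, y⟫ = ⟪x, M y⟫) (hinj : Function.Injective M) {s : ℝ} (hs : s < 0)
    {lam : ℝ} (hlam : 0 < lam) {e : E} (he : ‖e‖ = 1) (heig : M e = lam • e)
    (hsimple : ∀ u, M u = lam • u → ∃ c : ℝ, u = c • e)
    {F : E × E → ℝ}
    (hF : ∀ p, p.1 ≠ p.2 → F p = (1 / 2) * ⟪M p.1, p.1⟫ + (1 / 2) * ⟪M p.2, p.2⟫ +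
      (‖p.1 - p.2‖ ^ 2) ^ s) :
    ∃ p : E × E, p.1 ≠ p.2 ∧ fderiv ℝ F p = 0 ∧
      ∀ w, fderiv ℝ (fderiv ℝ F) p w = 0 → w = 0 := by
  obtain ⟨r, hr, hrs⟩ : ∃ r : ℝ, 0 < r ∧ 2 * s * (r ^ 2) ^ (s - 1) = -lam / 2 := by
    have hb : 0 < -lam / (4 * s) := div_pos_of_neg_of_neg (by linarith) (by linarith)
    have hq : 0 < (-lam / (4 * s)) ^ (s - 1)⁻¹ := Real.rpow_pos_of_pos hb _
    refine ⟨√((-lam / (4 * s)) ^ (s - 1)⁻¹), Real.sqrt_pos.2 hq, ?_⟩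
    rw [Real.sq_sqrt hq.le, Real.rpow_inv_rpow hb.le (by linarith)]
    field [hs.ne]
  have he0 : e ≠ 0 := by
    rintro rfl
    simp at he
  obtain ⟨p, hp⟩ : ∃ p : E × E, p = ((r / 2) • e, -(r / 2) • e) := ⟨_, rfl⟩
  have hpz : p.1 - p.2 = r • e := by
    rw [hp]
    module
  have hne : p.1 ≠ p.2 := by
    rw [← sub_ne_zero, hpz]
    exact smul_ne_zero hr.ne' he0
  have hnorm : ‖p.1 - p.2‖ = r := by rw [hpz, norm_smul, he, Real.norm_of_nonneg hr.le, mul_one]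
  obtain ⟨h1, h2⟩ := fderiv_and_fderiv_fderiv M hM s hF hne
  rw [hnorm, hrs] at h1
  simp only [hnorm, hrs] at h2
  simp only [hpz] at h2
  refine ⟨p, hne, ?_, fun w hw => ?_⟩
  · rw [h1]
    refine ContinuousLinearMap.ext fun v => ?_
    simp only [add_apply, smul_apply, sumForm_apply,
      innerPullback_apply, diffCLM_apply, hpz, zero_apply]
    simp only [hp, map_smul, heig, inner_smul_left, inner_sub_right, smul_eq_mul]
    simp
    ring
  have hw' : ∀ v, _ := fun v => (h2 w v).symm.trans (by rw [hw]; rfl : _ = (0 : ℝ))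
  obtain ⟨C, hC⟩ : ∃ C : ℝ, C = 4 * s * (s - 1) * (r ^ 2) ^ (s - 2) * r ^ 2 := ⟨_, rfl⟩
  have hC0 : 0 < C := by
    have : 0 < 4 * s * (s - 1) := by nlinarith
    rw [hC]
    positivity
  have hneg : w.2 = -w.1 := by
    rw [← add_eq_zero_iff_eq_neg']
    apply hinj
    rw [map_zero, ← inner_self_eq_zero (𝕜 := ℝ)]
    have := hw' (M (w.1 + w.2), M (w.1 + w.2))
    simpa [← inner_add_left, ← map_add] using this
  have hker : M w.1 - lam • w.1 + (2 * C * ⟪e, w.1⟫) • e = 0 := by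
    refine ext_inner_right ℝ fun a => ?_
    have := hw' (a, 0)
    simp only [hneg, sub_neg_eq_add, sub_zero, inner_zero_right, inner_add_left, inner_add_right,
      inner_smul_left, RCLike.conj_to_real] at this
    simp only [hC, inner_add_left, inner_sub_left, inner_smul_left, inner_zero_left,
      RCLike.conj_to_real]
    linear_combination this
  have horth : ⟪e, w.1⟫ = 0 := by
    have := congrArg (fun a => ⟪e, a⟫) hker
    simp only [inner_add_right, inner_sub_right, inner_smul_right, ← hM, heig, inner_smul_left,
      real_inner_self_eq_norm_sq, he, inner_zero_right] at this
    simpa [hC0.ne'] using this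
  obtain ⟨c, hc⟩ := hsimple w.1 (by simpa [horth, sub_eq_zero] using hker)
  have hc0 : c = 0 := by
    simpa [hc, inner_smul_right, real_inner_self_eq_norm_sq, he] using horth
  have hw1 : w.1 = 0 := by simp [hc, hc0]
  exact Prod.ext hw1 (by simp [hneg, hw1])

end PowerOfDifference



/-- For each simple positive eigenvalue `lam` of the symmetric
non-degenerate matrix `M`, the function `F` has a non-degenerate critical point:
the Fréchet derivative of `F` vanishes there and the second Fréchet derivative,
viewed as a bilinear form, has trivial kernel. -/
theorem stmt_1 (n : ℕ) (hn : 5 ≤ n)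
    (M : EuclideanSpace ℝ (Fin (n - 1)) →ₗ[ℝ] EuclideanSpace ℝ (Fin (n - 1)))
    (hsymm : ∀ x y, ⟪M x, y⟫ = ⟪x, M y⟫)
    (hnondeg : Function.Bijective M)
    (lam : ℝ) (hlam : 0 < lam)
    (heig : Module.End.HasEigenvalue (M : Module.End ℝ (EuclideanSpace ℝ (Fin (n - 1)))) lam)
    (hsimple : Module.finrank ℝ
      (Module.End.eigenspace (M : Module.End ℝ (EuclideanSpace ℝ (Fin (n - 1)))) lam) = 1)
    (F : EuclideanSpace ℝ (Fin (n - 1)) × EuclideanSpace ℝ (Fin (n - 1)) → ℝ)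
    (hF : ∀ p, F p = (1 / 2) * ⟪M p.1, p.1⟫ + (1 / 2) * ⟪M p.2, p.2⟫
      + 1 / ‖p.1 - p.2‖ ^ (n - 2)) :
    ∃ p : EuclideanSpace ℝ (Fin (n - 1)) × EuclideanSpace ℝ (Fin (n - 1)),
      p.1 ≠ p.2 ∧ fderiv ℝ F p = 0 ∧
      ∀ w : EuclideanSpace ℝ (Fin (n - 1)) × EuclideanSpace ℝ (Fin (n - 1)),
        fderiv ℝ (fderiv ℝ F) p w = 0 → w = 0 := by
  have hn2 : 0 < n - 2 := by omega
  obtain ⟨v, hv, hv0⟩ := heig.exists_hasEigenvector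
  rw [Module.End.mem_eigenspace_iff] at hv
  have hvn : ‖v‖ ≠ 0 := norm_ne_zero_iff.2 hv0
  refine exists_nondegenerate_critical_point (LinearMap.toContinuousLinearMap M) hsymm
    hnondeg.injective (s := -((n - 2 : ℕ) : ℝ) / 2) (e := ‖v‖⁻¹ • v) ?_ hlam ?_ ?_ ?_ ?_
  · have : (0 : ℝ) < (n - 2 : ℕ) := by exact_mod_cast hn2
    linarith
  · rw [norm_smul, norm_inv, norm_norm, inv_mul_cancel₀ hvn]
  · rw [map_smul, LinearMap.coe_toContinuousLinearMap', hv, smul_comm]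
  · intro u hu
    have hvm : v ∈ Module.End.eigenspace M lam := Module.End.mem_eigenspace_iff.2 hv
    have hum : u ∈ Module.End.eigenspace M lam := Module.End.mem_eigenspace_iff.2 hu
    obtain ⟨c, hc⟩ := (finrank_eq_one_iff_of_nonzero' (⟨v, hvm⟩ : Module.End.eigenspace M lam)
      (by simpa using hv0)).1 hsimple ⟨u, hum⟩
    refine ⟨c * ‖v‖, ?_⟩
    rw [smul_smul, mul_assoc, mul_inv_cancel₀ hvn, mul_one]
    exact (congrArg Subtype.val hc).symm
  · intro p _
    rw [hF]
    congr 1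
    rw [← Real.rpow_natCast _ 2, ← Real.rpow_mul (norm_nonneg _), Nat.cast_ofNat,
      mul_div_cancel₀ _ two_ne_zero, Real.rpow_neg (norm_nonneg _), Real.rpow_natCast, one_div]
end

section
/- Let n ≥ 5, and let M be a symmetric positive definite real (n−1)×(n−1) matrix. Define F on 𝔽₂(ℝ^{n−1}) = {(x,y) ∈ ℝ^{n−1}×ℝ^{n−1} : x ≠ y} by F(x,y) = (1/2)⟨Mx,x⟩ + (1/2)⟨My,y⟩ + 1/|x−y|^{n−2}. Then F attains its infimum on 𝔽₂(ℝ^{n−1}): there exists (x₀,y₀) with x₀ ≠ y₀ such that F(x₀,y₀) ≤ F(x,y) for all (x,y) with x ≠ y. -/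
open scoped RealInnerProductSpace

/-- A positive definite linear operator on a finite-dimensional real inner product space is
coercive. -/
theorem exists_pos_mul_sq_norm_le_inner {E : Type*} [NormedAddCommGroup E]
    [InnerProductSpace ℝ E] [FiniteDimensional ℝ E] (M : E →ₗ[ℝ] E)
    (hM : ∀ v : E, v ≠ 0 → 0 < ⟪M v, v⟫) :
    ∃ c : ℝ, 0 < c ∧ ∀ v : E, c * ‖v‖ ^ 2 ≤ ⟪M v, v⟫ := by
  have hcont : Continuous M := M.continuous_of_finiteDimensional
  rcases subsingleton_or_nontrivial E with hE | hE
  · exact ⟨1, one_pos, fun v => by simp [Subsingleton.elim v 0]⟩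
  obtain ⟨u, hu, hmin⟩ := (isCompact_sphere (0 : E) 1).exists_isMinOn
    (NormedSpace.sphere_nonempty.2 zero_le_one)
    (f := fun v => ⟪M v, v⟫) (by fun_prop)
  refine ⟨⟪M u, u⟫, hM u (ne_zero_of_mem_unit_sphere ⟨u, hu⟩), fun v => ?_⟩
  rcases eq_or_ne v 0 with rfl | hv
  · simp
  have hpos : 0 < ‖v‖ := norm_pos_iff.2 hv
  have hle : ⟪M u, u⟫ ≤ ⟪M (‖v‖⁻¹ • v), ‖v‖⁻¹ • v⟫ :=
    hmin (by simp [norm_smul, hpos.ne'])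
  calc ⟪M u, u⟫ * ‖v‖ ^ 2 ≤ ⟪M (‖v‖⁻¹ • v), ‖v‖⁻¹ • v⟫ * ‖v‖ ^ 2 := by gcongr
    _ = ⟪M v, v⟫ := by
      rw [map_smul, real_inner_smul_left, real_inner_smul_right]
      field_simp

/-- The energy of two particles confined by a positive definite quadratic potential and repelling
each other through an inverse power of their distance has a minimizer among pairs of distinct
points. -/
theorem exists_forall_le_quadratic_add_inv_norm_sub_pow {E : Type*} [NormedAddCommGroup E]
    [InnerProductSpace ℝ E] [FiniteDimensional ℝ E] [Nontrivial E] (M : E →ₗ[ℝ] E)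
    (hM : ∀ v : E, v ≠ 0 → 0 < ⟪M v, v⟫) {k : ℕ} (hk : k ≠ 0) (F : E × E → ℝ)
    (hF : ∀ p, F p = (1 / 2) * ⟪M p.1, p.1⟫ + (1 / 2) * ⟪M p.2, p.2⟫
      + 1 / ‖p.1 - p.2‖ ^ k) :
    ∃ p : E × E, p.1 ≠ p.2 ∧ ∀ q : E × E, q.1 ≠ q.2 → F p ≤ F q := by
  have hcont : Continuous M := M.continuous_of_finiteDimensional
  obtain ⟨c, hc, hcoer⟩ := exists_pos_mul_sq_norm_le_inner M hM
  have hnonneg (v : E) : 0 ≤ ⟪M v, v⟫ := le_trans (by positivity) (hcoer v)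
  have hdist {p : E × E} (hp : p.1 ≠ p.2) : 0 < ‖p.1 - p.2‖ ^ k :=
    pow_pos (norm_pos_iff.2 (sub_ne_zero.2 hp)) k
  obtain ⟨x, y, hxy⟩ := exists_pair_ne E
  set A := F (x, y) with hA
  have hApos : 0 < A := by
    have := one_div_pos.2 (hdist (p := (x, y)) hxy)
    rw [hA, hF]
    linarith [hnonneg x, hnonneg y]
  let K : Set (E × E) :=
    Metric.closedBall 0 (√(2 * A / c)) ∩ {p | 1 / A ≤ ‖p.1 - p.2‖ ^ k}
  have hK : IsCompact K :=
    (isCompact_closedBall _ _).inter_right (isClosed_le (by fun_prop) (by fun_prop))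
  have hKne {p : E × E} (hp : p ∈ K) : p.1 ≠ p.2 := by
    intro h
    have h1 : 1 / A ≤ ‖p.1 - p.2‖ ^ k := hp.2
    rw [h, sub_self, norm_zero, zero_pow hk] at h1
    exact absurd h1 (not_le.2 (one_div_pos.2 hApos))
  have hKmem {q : E × E} (hq : q.1 ≠ q.2) (hqA : F q ≤ A) : q ∈ K := by
    rw [hF] at hqA
    have hd := one_div_pos.2 (hdist hq)
    have hnorm {v : E} (hv : (1 / 2) * ⟪M v, v⟫ ≤ A) : ‖v‖ ≤ √(2 * A / c) := by
      refine Real.le_sqrt_of_sq_le ((le_div_iff₀ hc).2 ?_)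
      linarith [hcoer v]
    refine ⟨?_, ?_⟩
    · rw [mem_closedBall_zero_iff, Prod.norm_def]
      exact max_le (hnorm (by linarith [hnonneg q.2])) (hnorm (by linarith [hnonneg q.1]))
    · exact (one_div_le (hdist hq) hApos).1 (by linarith [hnonneg q.1, hnonneg q.2])
  have hFcont : ContinuousOn F K := by
    rw [funext hF]
    refine ContinuousOn.add (by fun_prop) (continuousOn_const.div (by fun_prop) ?_)
    exact fun p hp => (hdist (hKne hp)).ne'
  have hxyK : (x, y) ∈ K := hKmem hxy le_rfl
  obtain ⟨p, hp, hmin⟩ := hK.exists_isMinOn ⟨_, hxyK⟩ hFcont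
  refine ⟨p, hKne hp, fun q hq => ?_⟩
  rcases le_total (F q) A with h | h
  · exact hmin (hKmem hq h)
  · exact (hmin hxyK).trans h

/-- If `M` is symmetric positive definite, the function `F` attains its
infimum on the configuration space `𝔽₂(ℝ^{n-1})`. -/
theorem stmt_2 (n : ℕ) (hn : 5 ≤ n)
    (M : EuclideanSpace ℝ (Fin (n - 1)) →ₗ[ℝ] EuclideanSpace ℝ (Fin (n - 1)))
    (hsymm : ∀ x y, ⟪M x, y⟫ = ⟪x, M y⟫)
    (hposdef : ∀ v : EuclideanSpace ℝ (Fin (n - 1)), v ≠ 0 → 0 < ⟪M v, v⟫)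
    (F : EuclideanSpace ℝ (Fin (n - 1)) × EuclideanSpace ℝ (Fin (n - 1)) → ℝ)
    (hF : ∀ p, F p = (1 / 2) * ⟪M p.1, p.1⟫ + (1 / 2) * ⟪M p.2, p.2⟫
      + 1 / ‖p.1 - p.2‖ ^ (n - 2)) :
    ∃ p : EuclideanSpace ℝ (Fin (n - 1)) × EuclideanSpace ℝ (Fin (n - 1)),
      p.1 ≠ p.2 ∧ ∀ q : EuclideanSpace ℝ (Fin (n - 1)) × EuclideanSpace ℝ (Fin (n - 1)),
        q.1 ≠ q.2 → F p ≤ F q := by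
  have : Nontrivial (EuclideanSpace ℝ (Fin (n - 1))) :=
    Module.nontrivial_of_finrank_pos (R := ℝ) (by rw [finrank_euclideanSpace_fin]; omega)
  exact exists_forall_le_quadratic_add_inv_norm_sub_pow M hposdef (by omega) F hF
end

section
/- Let n ≥ 5, let M be a symmetric non-degenerate real (n−1)×(n−1) matrix, let λ > 0 be an eigenvalue of M, set c̄ = (n−2)/2^{n−1}, and let x̄ ∈ ℝ^{n−1} be a nonzero solution of M x̄ = c̄ x̄/|x̄|^n (so |x̄|^n = c̄/λ when x̄ is an eigenvector for λ). If x ∈ ℝ^{n−1} satisfies the linearized equation Mx = c̄ x/|x̄|^n − n c̄ ⟨x̄, x⟩ x̄/|x̄|^{n+2}, then ⟨x, x̄⟩ = 0 and Mx = λx; that is, x lies in the eigenspace of M for λ and is orthogonal to x̄. -/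
open scoped RealInnerProductSpace

/-- Key non-degeneracy step. If `x̄ ≠ 0` satisfies `M x̄ = c̄ x̄/|x̄|^n`
and `|x̄|^n = c̄/λ` (as holds when `x̄` is an eigenvector for the positive eigenvalue
`λ`), and `x` satisfies the linearized equation
`Mx = c̄ x/|x̄|^n - n c̄ ⟨x̄, x⟩ x̄/|x̄|^(n+2)`, then `⟨x, x̄⟩ = 0` and `Mx = λx`. -/
theorem stmt_9 (n : ℕ) (hn : 5 ≤ n)
    (M : EuclideanSpace ℝ (Fin (n - 1)) →ₗ[ℝ] EuclideanSpace ℝ (Fin (n - 1)))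
    (hsymm : ∀ x y, ⟪M x, y⟫ = ⟪x, M y⟫)
    (hnondeg : Function.Bijective M)
    (lam : ℝ) (hlam : 0 < lam)
    (c : ℝ) (hc : c = ((n : ℝ) - 2) / 2 ^ (n - 1))
    (xbar : EuclideanSpace ℝ (Fin (n - 1))) (hxbar : xbar ≠ 0)
    (hcrit : M xbar = (c / ‖xbar‖ ^ n) • xbar)
    (hnorm : ‖xbar‖ ^ n = c / lam)
    (x : EuclideanSpace ℝ (Fin (n - 1)))
    (hlin : M x = (c / ‖xbar‖ ^ n) • x
      - ((n : ℝ) * c * ⟪xbar, x⟫ / ‖xbar‖ ^ (n + 2)) • xbar) :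
    ⟪x, xbar⟫ = 0 ∧ M x = lam • x := by
  have hpos : 0 < ‖xbar‖ := norm_pos_iff.mpr hxbar
  have hn' : (0 : ℝ) < n := by exact_mod_cast (by omega : 0 < n)
  have hc_eq : c = lam * ‖xbar‖ ^ n := by
    rw [hnorm]
    field_simp
  have hc0 : 0 < c := by
    rw [hc_eq]
    positivity
  have hratio : c / ‖xbar‖ ^ n = lam := by
    rw [hc_eq]
    field_simp
  rw [hratio] at hcrit hlin
  -- Pairing the linearized equation with `xbar` and using symmetry kills the `lam` terms.
  have hpair := hsymm x xbar
  rw [hlin, hcrit, inner_sub_left, real_inner_smul_left, real_inner_smul_left,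
    real_inner_smul_right, real_inner_self_eq_norm_sq, sub_eq_self] at hpair
  have horth : ⟪xbar, x⟫ = 0 := by
    by_contra h
    have : (n : ℝ) * c * ⟪xbar, x⟫ / ‖xbar‖ ^ (n + 2) * ‖xbar‖ ^ 2 ≠ 0 := by positivity
    exact this hpair
  refine ⟨by rw [real_inner_comm, horth], ?_⟩
  simpa [horth] using hlin
end

section
/- Let n ≥ 5, m ≥ 2, and let M be a symmetric real (n−1)×(n−1) matrix which is negative semidefinite, i.e. ⟨Mv,v⟩ ≤ 0 for all v ∈ ℝ^{n−1}. Define 𝓕 on 𝔽_m(ℝ^{n−1}) = {(ξ₁,…,ξ_m) ∈ (ℝ^{n−1})^m : ξ_i ≠ ξ_j for i ≠ j} by 𝓕(ξ₁,…,ξ_m) = (1/2)∑_{i=1}^m ⟨Mξ_i, ξ_i⟩ + ∑_{1≤i<j≤m} 1/|ξ_i − ξ_j|^{n−2}. Then 𝓕 has no critical point: the Fréchet derivative of 𝓕 is nonzero at every point of 𝔽_m(ℝ^{n−1}). -/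
open scoped RealInnerProductSpace

/-- The quadratic form plus pair-interaction energy is differentiable at every configuration of
pairwise distinct points. -/
lemma differentiableAt_quadratic_add_pairEnergy {E : Type*} [NormedAddCommGroup E]
    [InnerProductSpace ℝ E] [FiniteDimensional ℝ E] {m : ℕ} (k : ℕ) (M : E →ₗ[ℝ] E)
    {ξ : Fin m → E} (hξ : ∀ i j, i ≠ j → ξ i ≠ ξ j) :
    DifferentiableAt ℝ (fun ξ : Fin m → E => (1 / 2) * ∑ i, ⟪M (ξ i), ξ i⟫
      + ∑ i, ∑ j, if i < j then 1 / ‖ξ i - ξ j‖ ^ k else 0) ξ := by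
  have hcoord (i : Fin m) : DifferentiableAt ℝ (fun ξ : Fin m → E => ξ i) ξ :=
    differentiableAt_apply i ξ
  refine DifferentiableAt.add (DifferentiableAt.const_mul ?_ _) ?_
  · refine DifferentiableAt.fun_sum fun i _ => DifferentiableAt.inner ℝ ?_ (hcoord i)
    exact (M.toContinuousLinearMap.differentiableAt).comp ξ (hcoord i)
  · refine DifferentiableAt.fun_sum fun i _ => DifferentiableAt.fun_sum fun j _ => ?_
    split_ifs with hij
    · have hne : ξ i - ξ j ≠ 0 := sub_ne_zero.mpr (hξ i j hij.ne)
      have hpow : DifferentiableAt ℝ (fun ξ : Fin m → E => ‖ξ i - ξ j‖ ^ k) ξ :=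
        (((hcoord i).fun_sub (hcoord j)).norm ℝ hne).fun_pow k
      simp only [one_div]
      exact hpow.fun_inv (pow_ne_zero _ (norm_ne_zero_iff.mpr hne))
    · exact differentiableAt_const _

/-- Behaviour of the energy under dilations of the configuration. -/
lemma quadratic_add_pairEnergy_smul {E : Type*} [NormedAddCommGroup E]
    [InnerProductSpace ℝ E] {m : ℕ} (k : ℕ) (M : E →ₗ[ℝ] E) (ξ : Fin m → E) {t : ℝ}
    (ht : 0 < t) :
    (1 / 2) * ∑ i, ⟪M ((t • ξ) i), (t • ξ) i⟫
      + ∑ i, ∑ j, (if i < j then 1 / ‖(t • ξ) i - (t • ξ) j‖ ^ k else 0)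
    = t ^ 2 * ((1 / 2) * ∑ i, ⟪M (ξ i), ξ i⟫)
      + (t ^ k)⁻¹ * ∑ i, ∑ j, (if i < j then 1 / ‖ξ i - ξ j‖ ^ k else 0) := by
  congr 1
  · simp only [Finset.mul_sum]
    refine Finset.sum_congr rfl fun i _ => ?_
    simp only [Pi.smul_apply, map_smul, real_inner_smul_left, real_inner_smul_right]
    ring
  · simp only [Finset.mul_sum]
    refine Finset.sum_congr rfl fun i _ => Finset.sum_congr rfl fun j _ => ?_
    split_ifs
    · rw [Pi.smul_apply, Pi.smul_apply, ← smul_sub, norm_smul, Real.norm_of_nonneg ht.le, mul_pow,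
        one_div, one_div, mul_inv]
    · simp

/-- The interaction energy of at least two distinct points is positive. -/
lemma pairEnergy_pos {E : Type*} [NormedAddCommGroup E] {m : ℕ} (k : ℕ) (hm : 2 ≤ m)
    {ξ : Fin m → E} (hξ : ∀ i j, i ≠ j → ξ i ≠ ξ j) :
    0 < ∑ i, ∑ j, (if i < j then 1 / ‖ξ i - ξ j‖ ^ k else 0) := by
  have hnonneg (i j : Fin m) : 0 ≤ (if i < j then 1 / ‖ξ i - ξ j‖ ^ k else 0) := by
    split_ifs <;> positivity
  refine Finset.sum_pos' (fun i _ => Finset.sum_nonneg fun j _ => hnonneg i j)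
    ⟨⟨0, by omega⟩, Finset.mem_univ _, Finset.sum_pos' (fun j _ => hnonneg _ j)
      ⟨⟨1, by omega⟩, Finset.mem_univ _, ?_⟩⟩
  have hlt : (⟨0, by omega⟩ : Fin m) < ⟨1, by omega⟩ := by simp
  rw [if_pos hlt]
  have := norm_pos_iff.mpr (sub_ne_zero.mpr (hξ _ _ hlt.ne))
  positivity

/-- If the symmetric matrix `M` is negative semidefinite, the
Kirchhoff-Routh function `𝓕` has no critical point on the configuration space
`𝔽_m(ℝ^{n-1})`. -/
theorem stmt_11 (n m : ℕ) (hn : 5 ≤ n) (hm : 2 ≤ m)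
    (M : EuclideanSpace ℝ (Fin (n - 1)) →ₗ[ℝ] EuclideanSpace ℝ (Fin (n - 1)))
    (hsymm : ∀ x y, ⟪M x, y⟫ = ⟪x, M y⟫)
    (hneg : ∀ v : EuclideanSpace ℝ (Fin (n - 1)), ⟪M v, v⟫ ≤ 0)
    (G : (Fin m → EuclideanSpace ℝ (Fin (n - 1))) → ℝ)
    (hG : ∀ ξ, G ξ = (1 / 2) * ∑ i, ⟪M (ξ i), ξ i⟫
      + ∑ i, ∑ j, if i < j then 1 / ‖ξ i - ξ j‖ ^ (n - 2) else 0) :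
    ∀ ξ : Fin m → EuclideanSpace ℝ (Fin (n - 1)),
      (∀ i j, i ≠ j → ξ i ≠ ξ j) → fderiv ℝ G ξ ≠ 0 := by
  intro ξ hξ hcrit
  have hdiff : DifferentiableAt ℝ G ξ := by
    rw [funext hG]
    exact differentiableAt_quadratic_add_pairEnergy (n - 2) M hξ
  have hfderiv : HasFDerivAt G (0 : _ →L[ℝ] ℝ) ξ := hcrit ▸ hdiff.hasFDerivAt
  have hcurve : HasDerivAt (fun t : ℝ => t • ξ) ((1 : ℝ) • ξ) 1 :=
    (hasDerivAt_id (1 : ℝ)).smul_const ξ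
  have hzero : HasDerivAt (fun t : ℝ => G (t • ξ)) 0 1 := by
    have hfderiv' : HasFDerivAt G (0 : _ →L[ℝ] ℝ) ((1 : ℝ) • ξ) := by rwa [one_smul]
    exact hfderiv'.comp_hasDerivAt (1 : ℝ) hcurve
  have hquad : ∑ i, ⟪M (ξ i), ξ i⟫ ≤ 0 := Finset.sum_nonpos fun i _ => hneg (ξ i)
  have hpair := pairEnergy_pos (n - 2) hm hξ
  have hk : (0 : ℝ) < ((n - 2 : ℕ) : ℝ) := by
    exact_mod_cast (by omega : 0 < n - 2)
  set P := ∑ i, ⟪M (ξ i), ξ i⟫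
  set Q := ∑ i, ∑ j, (if i < j then 1 / ‖ξ i - ξ j‖ ^ (n - 2) else 0)
  have hscale : (fun t : ℝ => G (t • ξ)) =ᶠ[nhds 1]
      fun t => t ^ 2 * ((1 / 2) * P) + (t ^ (n - 2))⁻¹ * Q := by
    filter_upwards [lt_mem_nhds (zero_lt_one' ℝ)] with t ht
    rw [hG, quadratic_add_pairEnergy_smul (n - 2) M ξ ht]
  have hradial : HasDerivAt (fun t : ℝ => t ^ 2 * ((1 / 2) * P) + (t ^ (n - 2))⁻¹ * Q)
      (P - ((n - 2 : ℕ) : ℝ) * Q) 1 := by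
    have hinv := ((hasDerivAt_pow (n - 2) (1 : ℝ)).fun_inv (by simp)).mul_const Q
    have hsq := (hasDerivAt_pow 2 (1 : ℝ)).mul_const ((1 / 2) * P)
    refine (hsq.add hinv).congr_deriv ?_
    simp only [one_pow, mul_one]
    push_cast
    ring
  have := hzero.unique (hradial.congr_of_eventuallyEq hscale)
  nlinarith [mul_pos hk hpair]
end
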